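/- Let ρ be an absolutely PPT density matrix on ℂ³ ⊗ ℂ³. Then (id_3 ⊗ Φ_C)(ρ) is positive semidefinite, where Φ_C is the Choi map. That is, the Choi map cannot detect entanglement in any absolutely PPT state. -/

import Mathlib

open Matrix BigOperators
open scoped ComplexOrder

noncomputable section

/-- The Choi map `Φ_C : M₃(ℂ) → M₃(ℂ)`. -/
def PhiC (X : Matrix (Fin 3) (Fin 3) ℂ) : Matrix (Fin 3) (Fin 3) ℂ :=
  (1 / 2 : ℂ) •
    !![X 0 0 + X 1 1, -(X 0 1), -(X 0 2);
       -(X 1 0), X 1 1 + X 2 2, -(X 1 2);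
       -(X 2 0), -(X 2 1), X 2 2 + X 0 0]


/-- The map `id_n ⊗ Φ`, acting blockwise on an `n² × n²` matrix indexed by
`Fin n × Fin n`. -/
def idTensor {n : ℕ} (Φ : Matrix (Fin n) (Fin n) ℂ → Matrix (Fin n) (Fin n) ℂ)
    (X : Matrix (Fin n × Fin n) (Fin n × Fin n) ℂ) :
    Matrix (Fin n × Fin n) (Fin n × Fin n) ℂ :=
  Matrix.of fun p q => Φ (Matrix.of fun k l => X (p.1, k) (q.1, l)) p.2 q.2


/-- The partial transpose (on the second factor) of a matrix indexed by `Fin m × Fin n`. -/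
def partialTranspose {m n : ℕ} (X : Matrix (Fin m × Fin n) (Fin m × Fin n) ℂ) :
    Matrix (Fin m × Fin n) (Fin m × Fin n) ℂ :=
  Matrix.of fun p q => X (p.1, q.2) (q.1, p.2)

/-- A state is absolutely PPT if every unitary conjugate has positive semidefinite
partial transpose. -/
def AbsolutelyPPT {m n : ℕ} (ρ : Matrix (Fin m × Fin n) (Fin m × Fin n) ℂ) : Prop :=
  ∀ U : Matrix (Fin m × Fin n) (Fin m × Fin n) ℂ,
    U ∈ Matrix.unitaryGroup (Fin m × Fin n) ℂ →
      (partialTranspose (U * ρ * Uᴴ)).PosSemidef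


lemma real_form_upper (x y z a b c : ℝ) :
    2 * (x ^ 2 * a ^ 2 + y ^ 2 * b ^ 2 + z ^ 2 * c ^ 2) - (x * a + y * b + z * c) ^ 2 ≤
      (x ^ 2 + y ^ 2 + z ^ 2) * (a ^ 2 + b ^ 2 + c ^ 2) := by
  nlinarith [sq_nonneg (y * a + x * b), sq_nonneg (z * a + x * c), sq_nonneg (z * b + y * c)]

lemma real_form_lower {s A B z : ℝ} (hs : 0 ≤ s) (hA : 0 ≤ A) (hB : 0 ≤ B) (hz : 0 ≤ z)
    (hAB : A ^ 2 + B ^ 2 = 1) (a b c : ℝ) :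
    -(A * B * z * s) * (B * a + A * b + c) ^ 2 ≤
      2 * ((s * A) ^ 2 * a ^ 2 + (s * B) ^ 2 * b ^ 2 + z ^ 2 * c ^ 2) -
        (s * A * a + s * B * b + z * c) ^ 2 := by
  have h : 0 ≤ (s * (A * a - B * b) - z * (A ^ 2 - B ^ 2) * c) ^ 2 +
      4 * (z * A * B * c) ^ 2 + (A * B * z * s) * (B * a + A * b - c) ^ 2 := by positivity
  refine le_of_sub_nonneg (h.trans_eq ?_)
  have h1 : B ^ 2 = 1 - A ^ 2 := by linarith
  grind

lemma complex_form_upper (x y z : ℝ) (a b c : ℂ) :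
    2 * (x ^ 2 * ‖a‖ ^ 2 + y ^ 2 * ‖b‖ ^ 2 + z ^ 2 * ‖c‖ ^ 2) - ‖x * a + y * b + z * c‖ ^ 2 ≤
      (x ^ 2 + y ^ 2 + z ^ 2) * (‖a‖ ^ 2 + ‖b‖ ^ 2 + ‖c‖ ^ 2) := by
  have h1 := real_form_upper x y z a.re b.re c.re
  have h2 := real_form_upper x y z a.im b.im c.im
  simp only [← Complex.normSq_eq_norm_sq, Complex.normSq_apply, Complex.add_re, Complex.add_im,
    Complex.re_ofReal_mul, Complex.im_ofReal_mul]
  linarith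

lemma complex_form_lower {s A B z : ℝ} (hs : 0 ≤ s) (hA : 0 ≤ A) (hB : 0 ≤ B) (hz : 0 ≤ z)
    (hAB : A ^ 2 + B ^ 2 = 1) (a b c : ℂ) :
    -(A * B * z * s) * ‖B * a + A * b + c‖ ^ 2 ≤
      2 * ((s * A) ^ 2 * ‖a‖ ^ 2 + (s * B) ^ 2 * ‖b‖ ^ 2 + z ^ 2 * ‖c‖ ^ 2) -
        ‖(s * A : ℝ) * a + (s * B : ℝ) * b + z * c‖ ^ 2 := by
  have h1 := real_form_lower hs hA hB hz hAB a.re b.re c.re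
  have h2 := real_form_lower hs hA hB hz hAB a.im b.im c.im
  simp only [← Complex.normSq_eq_norm_sq, Complex.normSq_apply, Complex.add_re, Complex.add_im,
    Complex.re_ofReal_mul, Complex.im_ofReal_mul]
  linarith

lemma weighted_sum_nonneg {l M G t : Fin 9 → ℝ} {N m w : ℝ} (hl : Antitone l) (hl0 : 0 ≤ l 8)
    (hm : 0 ≤ m) (hMsum : ∑ i, M i = N) (hM8 : M 8 ≤ N) (hM : ∀ i, -m * t i ≤ M i)
    (ht : ∀ i, 0 ≤ t i) (htsum : ∑ i, t i = 1)
    (hG : ∀ i, 0 ≤ G i) (hG1 : ∀ i, G i ≤ w) (hGsum : ∑ i, G i = 3 * w)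
    (hfin : m * (l 0 - l 7) ≤ N * l 8 + w * l 6) :
    0 ≤ ∑ i, l i * (M i + G i) := by
  have key : ∀ i, i ≠ 8 → -(m * (l 0 - l 7)) * t i ≤ (l i - l 7) * M i := by
    intro i hi
    have h7 : l 7 ≤ l i := hl (by omega)
    have h0 : l i ≤ l 0 := hl (Fin.zero_le i)
    have := mul_le_mul_of_nonneg_left (hM i) (sub_nonneg.2 h7)
    nlinarith [mul_nonneg hm (ht i)]
  have key8 : (l 8 - l 7) * N ≤ (l 8 - l 7) * M 8 :=
    mul_le_mul_of_nonpos_left hM8 (sub_nonpos.2 (hl (by decide)))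
  have h80 : 0 ≤ m * (l 0 - l 7) * t 8 :=
    mul_nonneg (mul_nonneg hm (sub_nonneg.2 (hl (by decide)))) (ht 8)
  have hMtot : N * l 8 - m * (l 0 - l 7) ≤ ∑ i, l i * M i := by
    have e1 : ∑ i, (l i - l 7) * M i = ∑ i, l i * M i - l 7 * N := by
      rw [← hMsum, Finset.mul_sum, ← Finset.sum_sub_distrib]
      exact Finset.sum_congr rfl fun i _ => by ring
    have e2 : ∑ i, -(m * (l 0 - l 7)) * t i = -(m * (l 0 - l 7)) := by
      rw [← Finset.mul_sum, htsum, mul_one]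
    rw [Fin.sum_univ_castSucc] at e1 e2
    have e3 := Finset.sum_le_sum fun (i : Fin 8) (_ : i ∈ Finset.univ) =>
      key i.castSucc (Fin.castSucc_ne_last i)
    simp only [Fin.reduceLast] at e1 e2
    linarith
  have hGtot : w * l 6 ≤ ∑ i, l i * G i := by
    have e1 : ∀ i, i ≠ 7 → i ≠ 8 → l 6 * G i ≤ l i * G i := fun i h7 h8 =>
      mul_le_mul_of_nonneg_right (hl (by omega)) (hG i)
    have e2 := Finset.sum_le_sum fun (i : Fin 7) (_ : i ∈ Finset.univ) =>
      e1 i.castSucc.castSucc (by simp [Fin.ext_iff]; omega) (by simp [Fin.ext_iff]; omega)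
    rw [← Finset.mul_sum] at e2
    rw [Fin.sum_univ_castSucc, Fin.sum_univ_castSucc] at hGsum ⊢
    simp only [Fin.reduceLast, Fin.reduceCastSucc] at hGsum ⊢
    have l6 : 0 ≤ l 6 := hl0.trans (hl (by decide))
    have l7 : 0 ≤ l 7 := hl0.trans (hl (by decide))
    nlinarith [mul_nonneg l7 (hG 7), mul_nonneg hl0 (hG 8), hG1 7, hG1 8]
  simp only [mul_add, Finset.sum_add_distrib]
  linarith

section
variable {E : Type*} [NormedAddCommGroup E] [InnerProductSpace ℂ E]

lemma choi_form_nonneg_of_min (b : OrthonormalBasis (Fin 9) ℂ E) {l : Fin 9 → ℝ} (hl : Antitone l)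
    (hl0 : 0 ≤ l 8) (hppt : ∀ α β : ℝ, α * β * (l 0 - l 7) ≤ α ^ 2 * l 8 + β ^ 2 * l 6)
    {f g : Fin 3 → E} (hf : Orthonormal ℂ f) (hg : Orthonormal ℂ g) {p : Fin 3 → ℝ}
    (hp : ∀ j, 0 ≤ p j) (h0 : p 2 ≤ p 0) (h1 : p 2 ≤ p 1) :
    0 ≤ ∑ i, l i * (∑ j, p j ^ 2 * (2 * ‖inner ℂ (b i) (f j)‖ ^ 2 + ‖inner ℂ (b i) (g j)‖ ^ 2) -
      ‖inner ℂ (b i) (∑ j, (p j : ℂ) • f j)‖ ^ 2) := by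
  obtain ⟨s, A, B, hs, hA, hB, hAB, hsA, hsB⟩ : ∃ s A B : ℝ, 0 ≤ s ∧ 0 ≤ A ∧ 0 ≤ B ∧
      A ^ 2 + B ^ 2 = 1 ∧ p 0 = s * A ∧ p 1 = s * B := by
    rcases eq_or_ne (p 0 ^ 2 + p 1 ^ 2) 0 with h | h
    · refine ⟨0, 1, 0, le_rfl, zero_le_one, le_rfl, by norm_num, ?_, ?_⟩ <;>
        nlinarith [sq_nonneg (p 0), sq_nonneg (p 1)]
    · have hs : Real.sqrt (p 0 ^ 2 + p 1 ^ 2) ≠ 0 :=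
        (Real.sqrt_pos.2 (lt_of_le_of_ne (by positivity) h.symm)).ne'
      refine ⟨Real.sqrt (p 0 ^ 2 + p 1 ^ 2), p 0 / Real.sqrt (p 0 ^ 2 + p 1 ^ 2),
        p 1 / Real.sqrt (p 0 ^ 2 + p 1 ^ 2), Real.sqrt_nonneg _, ?_, ?_, ?_, ?_, ?_⟩
      · exact div_nonneg (hp 0) (Real.sqrt_nonneg _)
      · exact div_nonneg (hp 1) (Real.sqrt_nonneg _)
      · rw [div_pow, div_pow, Real.sq_sqrt (by positivity), ← add_div, div_self h]
      · field_simp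
      · field_simp
  have hz := hp 2
  set z := p 2 with hzdef
  have norm_comb : ∀ a : Fin 3 → ℝ, ‖∑ j, (a j : ℂ) • f j‖ ^ 2 = ∑ j, a j ^ 2 := by
    intro a
    have h := hf.inner_sum (fun j => (a j : ℂ)) (fun j => (a j : ℂ)) Finset.univ
    rw [inner_self_eq_norm_sq_to_K] at h
    have h' := congrArg Complex.re h
    simpa [← Complex.ofReal_pow, pow_two] using h'
  have hbessel : ∀ {k : Fin 3 → E}, Orthonormal ℂ k → ∀ i, ∑ j, ‖inner ℂ (b i) (k j)‖ ^ 2 ≤ 1 := by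
    intro k hk i
    have h := hk.sum_inner_products_le (b i) (s := Finset.univ)
    simpa [norm_inner_symm (b i), b.norm_eq_one] using h
  have hparseval : ∀ x, ∑ i, ‖inner ℂ (b i) x‖ ^ 2 = ‖x‖ ^ 2 := b.sum_sq_norm_inner_right
  have hexp : ∀ (a : Fin 3 → ℝ) i, inner ℂ (b i) (∑ j, (a j : ℂ) • f j) =
      a 0 * inner ℂ (b i) (f 0) + a 1 * inner ℂ (b i) (f 1) + a 2 * inner ℂ (b i) (f 2) := by
    intro a i
    simp only [Fin.sum_univ_three, inner_add_right, inner_smul_right]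
  have main := weighted_sum_nonneg (l := l)
    (M := fun i => 2 * ∑ j, p j ^ 2 * ‖inner ℂ (b i) (f j)‖ ^ 2 -
      ‖inner ℂ (b i) (∑ j, (p j : ℂ) • f j)‖ ^ 2)
    (G := fun i => z ^ 2 * ∑ j, ‖inner ℂ (b i) (g j)‖ ^ 2)
    (t := fun i => ‖inner ℂ (b i) (∑ j, ((![B, A, 1] j : ℝ) : ℂ) • f j)‖ ^ 2 / 2)
    (N := ∑ j, p j ^ 2) (m := 2 * (A * B * z * s)) (w := z ^ 2) hl hl0 (by positivity)
    ?_ ?_ ?_ (fun i => by positivity) ?_ (fun i => by positivity) ?_ ?_ ?_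
  · refine main.trans (Finset.sum_le_sum fun i _ => mul_le_mul_of_nonneg_left ?_
      (hl0.trans (hl (Fin.le_last i))))
    have e0 : z ^ 2 ≤ p 0 ^ 2 := by gcongr
    have e1 : z ^ 2 ≤ p 1 ^ 2 := by gcongr
    have e2 := mul_le_mul_of_nonneg_right e0 (sq_nonneg ‖inner ℂ (b i) (g 0)‖)
    have e3 := mul_le_mul_of_nonneg_right e1 (sq_nonneg ‖inner ℂ (b i) (g 1)‖)
    simp only [Fin.sum_univ_three, ← hzdef]
    linarith
  · rw [Finset.sum_sub_distrib, hparseval, norm_comb, ← Finset.mul_sum, Finset.sum_comm]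
    simp_rw [← Finset.mul_sum, hparseval, hf.norm_eq_one]
    simp only [one_pow, mul_one]
    ring
  · have h := complex_form_upper (p 0) (p 1) (p 2) (inner ℂ (b 8) (f 0)) (inner ℂ (b 8) (f 1))
      (inner ℂ (b 8) (f 2))
    have h2 := hbessel hf 8
    rw [← hexp] at h
    rw [Fin.sum_univ_three] at h2
    rw [Fin.sum_univ_three (fun j => p j ^ 2 * _), Fin.sum_univ_three (fun j => p j ^ 2)]
    exact h.trans (mul_le_of_le_one_right (by positivity) h2)
  · intro i
    have h := complex_form_lower hs hA hB hz hAB (inner ℂ (b i) (f 0)) (inner ℂ (b i) (f 1))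
      (inner ℂ (b i) (f 2))
    rw [← hsA, ← hsB, hzdef, ← hexp] at h
    have h2 := hexp ![B, A, 1] i
    simp only [Matrix.cons_val, Complex.ofReal_one, one_mul] at h2
    rw [h2, Fin.sum_univ_three (fun j => p j ^ 2 * _)]
    exact le_trans (le_of_eq (by ring)) h
  · rw [← Finset.sum_div, hparseval, norm_comb]
    simp only [Fin.sum_univ_three, Matrix.cons_val]
    linarith
  · exact fun i => mul_le_of_le_one_right (by positivity) (hbessel hg i)
  · rw [← Finset.mul_sum, Finset.sum_comm]
    simp_rw [hparseval, hg.norm_eq_one]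
    simp only [one_pow, Finset.sum_const, Finset.card_univ, Fintype.card_fin, nsmul_eq_mul]
    push_cast
    ring
  · have h07 : 0 ≤ l 0 - l 7 := sub_nonneg.2 (hl (by decide))
    have e1 : 2 * (A * B * z * s) ≤ s * z := by
      nlinarith [mul_nonneg hz hs, mul_nonneg (mul_nonneg hz hs) (sq_nonneg (A - B))]
    have e2 := mul_le_mul_of_nonneg_right e1 h07
    have e3 : s ^ 2 ≤ ∑ j, p j ^ 2 := by
      rw [Fin.sum_univ_three, hsA, hsB]
      nlinarith [sq_nonneg (p 2)]
    have e4 := mul_le_mul_of_nonneg_right e3 hl0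
    linarith [hppt s z]

lemma choi_form_nonneg (b : OrthonormalBasis (Fin 9) ℂ E) {l : Fin 9 → ℝ} (hl : Antitone l)
    (hl0 : 0 ≤ l 8) (hppt : ∀ α β : ℝ, α * β * (l 0 - l 7) ≤ α ^ 2 * l 8 + β ^ 2 * l 6)
    {f g : Fin 3 → E} (hf : Orthonormal ℂ f) (hg : Orthonormal ℂ g) {p : Fin 3 → ℝ}
    (hp : ∀ j, 0 ≤ p j) :
    0 ≤ ∑ i, l i * (∑ j, p j ^ 2 * (2 * ‖inner ℂ (b i) (f j)‖ ^ 2 + ‖inner ℂ (b i) (g j)‖ ^ 2) -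
      ‖inner ℂ (b i) (∑ j, (p j : ℂ) • f j)‖ ^ 2) := by
  obtain ⟨k, hk⟩ := Finite.exists_min p
  set σ := Equiv.swap 2 k
  have hσ : σ 2 = k := Equiv.swap_apply_left 2 k
  have h := choi_form_nonneg_of_min b hl hl0 hppt (hf.comp σ σ.injective) (hg.comp σ σ.injective)
    (p := p ∘ σ) (fun j => hp _) (by simpa [hσ] using hk _) (by simpa [hσ] using hk _)
  refine h.trans_eq (Finset.sum_congr rfl fun i _ => ?_)
  rw [← Equiv.sum_comp σ (fun j => p j ^ 2 *
      (2 * ‖inner ℂ (b i) (f j)‖ ^ 2 + ‖inner ℂ (b i) (g j)‖ ^ 2)),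
    ← Equiv.sum_comp σ (fun j => (p j : ℂ) • f j)]
  rfl

end

lemma quadratic_form_of_absolutelyPPT {ρ : Matrix (Fin 3 × Fin 3) (Fin 3 × Fin 3) ℂ}
    (hppt : AbsolutelyPPT ρ)
    (c : OrthonormalBasis (Fin 3 × Fin 3) ℂ (EuclideanSpace ℂ (Fin 3 × Fin 3))) (α β : ℝ) :
    0 ≤ α ^ 2 * (star (c (0, 0)).ofLp ⬝ᵥ ρ *ᵥ (c (0, 0)).ofLp) +
      β ^ 2 * (star (c (1, 1)).ofLp ⬝ᵥ ρ *ᵥ (c (1, 1)).ofLp) +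
      α * β * (star (c (0, 1)).ofLp ⬝ᵥ ρ *ᵥ (c (1, 0)).ofLp +
        star (c (1, 0)).ofLp ⬝ᵥ ρ *ᵥ (c (0, 1)).ofLp) := by
  let U : Matrix (Fin 3 × Fin 3) (Fin 3 × Fin 3) ℂ := Matrix.of fun p q => star ((c p).ofLp q)
  have hU : U ∈ Matrix.unitaryGroup (Fin 3 × Fin 3) ℂ := by
    rw [Matrix.mem_unitaryGroup_iff]
    ext p q
    have h := c.inner_eq_ite p q
    rw [EuclideanSpace.inner_eq_star_dotProduct, dotProduct_comm] at h
    rw [Matrix.one_apply, ← h]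
    simp [Matrix.mul_apply, U, dotProduct]
  have hentry : ∀ p q, (U * ρ * Uᴴ) p q = star (c p).ofLp ⬝ᵥ ρ *ᵥ (c q).ofLp := by
    intro p q
    rw [Matrix.mul_assoc, Matrix.mul_apply]
    refine Finset.sum_congr rfl fun i _ => ?_
    rw [Matrix.mul_apply]
    simp [U, mulVec, dotProduct]
  have h := ((hppt U hU).submatrix ![((0 : Fin 3), (0 : Fin 3)), (1, 1)]).dotProduct_mulVec_nonneg
    ![(α : ℂ), (β : ℂ)]
  rw [dotProduct, Fin.sum_univ_two, mulVec, mulVec, dotProduct, dotProduct, Fin.sum_univ_two,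
    Fin.sum_univ_two] at h
  simp only [Matrix.submatrix_apply, partialTranspose,
    Matrix.of_apply, Pi.star_apply, Matrix.cons_val_zero, Matrix.cons_val_one, hentry,
    RCLike.star_def, Complex.conj_ofReal] at h
  exact h.trans_eq (by ring)

lemma dotProduct_mulVec_eigenvector {ι κ : Type*} [Fintype ι] [DecidableEq ι] [Fintype κ]
    {ρ : Matrix ι ι ℂ} (b : OrthonormalBasis κ ℂ (EuclideanSpace ℂ ι)) {l : κ → ℝ}
    (hb : ∀ i, ρ *ᵥ (b i).ofLp = (l i : ℂ) • (b i).ofLp) (x y : EuclideanSpace ℂ ι) :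
    star x.ofLp ⬝ᵥ ρ *ᵥ y.ofLp = ∑ i, (l i : ℂ) * (inner ℂ x (b i) * inner ℂ (b i) y) := by
  have hy : y.ofLp = ∑ i, inner ℂ (b i) y • (b i).ofLp := by
    conv_lhs => rw [← b.sum_repr' y]
    simp
  rw [hy, mulVec_sum, dotProduct_sum]
  refine Finset.sum_congr rfl fun i _ => ?_
  rw [mulVec_smul, hb, dotProduct_smul, dotProduct_smul, EuclideanSpace.inner_eq_star_dotProduct x,
    dotProduct_comm (b i).ofLp]
  simp only [smul_eq_mul]
  ring

lemma exists_antitone_eigenbasis {ρ : Matrix (Fin 3 × Fin 3) (Fin 3 × Fin 3) ℂ}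
    (hρ : ρ.PosSemidef) :
    ∃ (b : OrthonormalBasis (Fin 9) ℂ (EuclideanSpace ℂ (Fin 3 × Fin 3))) (l : Fin 9 → ℝ),
      Antitone l ∧ (∀ i, 0 ≤ l i) ∧ ∀ i, ρ *ᵥ (b i).ofLp = (l i : ℂ) • (b i).ofLp := by
  let e : Fin 3 × Fin 3 ≃ Fin 9 :=
    (Fintype.equivOfCardEq (Fintype.card_fin _)).symm
  let l : Fin 9 → ℝ := hρ.1.eigenvalues₀
  have he : ∀ i, hρ.1.eigenvalues i = l (e i) := fun _ => rfl
  refine ⟨hρ.1.eigenvectorBasis.reindex e, l, hρ.1.eigenvalues₀_antitone,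
    fun i => ?_, fun i => ?_⟩
  · have h := hρ.eigenvalues_nonneg (e.symm i)
    rwa [he, e.apply_symm_apply] at h
  · have h := hρ.1.mulVec_eigenvectorBasis (e.symm i)
    rw [he, e.apply_symm_apply] at h
    rw [OrthonormalBasis.reindex_apply]
    exact h

lemma eigenvalue_bound_of_absolutelyPPT {ρ : Matrix (Fin 3 × Fin 3) (Fin 3 × Fin 3) ℂ}
    (hppt : AbsolutelyPPT ρ)
    (b : OrthonormalBasis (Fin 9) ℂ (EuclideanSpace ℂ (Fin 3 × Fin 3))) {l : Fin 9 → ℝ}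
    (hb : ∀ i, ρ *ᵥ (b i).ofLp = (l i : ℂ) • (b i).ofLp) (α β : ℝ) :
    α * β * (l 0 - l 7) ≤ α ^ 2 * l 8 + β ^ 2 * l 6 := by
  let r : ℂ := ((Real.sqrt 2)⁻¹ : ℝ)
  have hrr : r * r = 1 / 2 := by
    rw [← Complex.ofReal_mul, ← mul_inv, Real.mul_self_sqrt zero_le_two]
    norm_num
  have hconj : (starRingEnd ℂ) r = r := Complex.conj_ofReal _
  let u : Fin 3 × Fin 3 → EuclideanSpace ℂ (Fin 3 × Fin 3) := fun q =>
    ![![b 8, r • (b 0 - b 7), 0], ![r • (b 0 + b 7), b 6, 0], 0] q.1 q.2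
  let s : Set (Fin 3 × Fin 3) := {q | q.1 ≠ 2 ∧ q.2 ≠ 2}
  have hu : Orthonormal ℂ (s.domRestrict u) := by
    rw [orthonormal_iff_ite]
    rintro ⟨⟨i, j⟩, hij⟩ ⟨⟨k, m⟩, hkm⟩
    fin_cases i <;> fin_cases j <;> fin_cases k <;> fin_cases m <;>
      first
      | exact absurd rfl hij.1
      | exact absurd rfl hij.2
      | exact absurd rfl hkm.1
      | exact absurd rfl hkm.2
      | (simp [-inner_self_eq_norm_sq_to_K, smul_add, smul_sub, u, Set.domRestrict, inner_smul_left, inner_smul_right, inner_add_left,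
          inner_add_right, inner_sub_left, inner_sub_right, b.inner_eq_ite, hconj]
         try linear_combination 2 * hrr)
  obtain ⟨c, hc⟩ := hu.exists_orthonormalBasis_extension_of_card_eq (by simp)
  have h := quadratic_form_of_absolutelyPPT hppt c α (-β)
  rw [hc (0, 0) (by simp [s]), hc (0, 1) (by simp [s]), hc (1, 0) (by simp [s]),
    hc (1, 1) (by simp [s])] at h
  have hbb : ∀ i j, star (b i).ofLp ⬝ᵥ (b j).ofLp = if i = j then 1 else 0 := fun i j => by
    rw [dotProduct_comm, ← EuclideanSpace.inner_eq_star_dotProduct, b.inner_eq_ite]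
  simp only [u, Matrix.cons_val, WithLp.ofLp_smul, WithLp.ofLp_sub, WithLp.ofLp_add, star_smul,
    star_sub, star_add, mulVec_smul, mulVec_sub, mulVec_add, hb, dotProduct_smul, smul_dotProduct,
    dotProduct_sub, sub_dotProduct, dotProduct_add, add_dotProduct, hbb, smul_eq_mul,
    RCLike.star_def, hconj] at h
  simp only [Fin.reduceEq, if_true, if_false] at h
  have h' : (0 : ℂ) ≤ ((α ^ 2 * l 8 + β ^ 2 * l 6 - α * β * (l 0 - l 7) : ℝ) : ℂ) := by
    refine h.trans_eq ?_
    push_cast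
    linear_combination -2 * (α : ℂ) * β * (l 0 - l 7) * hrr
  linarith [Complex.zero_le_real.1 h']

lemma idTensor_PhiC_isHermitian {ρ : Matrix (Fin 3 × Fin 3) (Fin 3 × Fin 3) ℂ}
    (hρ : ρ.IsHermitian) : (idTensor PhiC ρ).IsHermitian := by
  ext ⟨i, j⟩ ⟨k, m⟩
  have h := fun p q => hρ.apply p q
  simp only [RCLike.star_def] at h
  fin_cases j <;> fin_cases m <;>
    simp [idTensor, PhiC, Matrix.conjTranspose_apply, h]

/-- The elementary tensor `v ⊗ e_j`. -/
def tensorSingle (v : EuclideanSpace ℂ (Fin 3)) (j : Fin 3) : EuclideanSpace ℂ (Fin 3 × Fin 3) :=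
  WithLp.toLp 2 fun q => if q.2 = j then v q.1 else 0

lemma inner_tensorSingle (v w : EuclideanSpace ℂ (Fin 3)) (j k : Fin 3) :
    inner ℂ (tensorSingle v j) (tensorSingle w k) = if j = k then inner ℂ v w else 0 := by
  simp only [PiLp.inner_apply, tensorSingle, Fintype.sum_prod_type]
  split_ifs with h
  · subst h
    refine Finset.sum_congr rfl fun i _ => ?_
    rw [Finset.sum_eq_single j] <;> simp +contextual
  · refine Finset.sum_eq_zero fun i _ => Finset.sum_eq_zero fun m _ => ?_
    by_cases hm : m = j
    · subst hm; simp [h]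
    · simp [hm]

lemma orthonormal_tensorSingle {v : Fin 3 → EuclideanSpace ℂ (Fin 3)} (hv : ∀ j, ‖v j‖ = 1)
    {σ : Fin 3 → Fin 3} (hσ : Function.Injective σ) :
    Orthonormal ℂ fun j => tensorSingle (v j) (σ j) := by
  rw [orthonormal_iff_ite]
  intro j k
  rw [inner_tensorSingle]
  by_cases h : j = k
  · subst h
    simp [inner_self_eq_norm_sq_to_K, hv]
  · simp [h, hσ.ne h]

lemma tensorSingle_smul (a : ℂ) (v : EuclideanSpace ℂ (Fin 3)) (j : Fin 3) :
    tensorSingle (a • v) j = a • tensorSingle v j := by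
  ext q
  simp [tensorSingle]

lemma sum_tensorSingle (x : EuclideanSpace ℂ (Fin 3 × Fin 3)) :
    ∑ j, tensorSingle (WithLp.toLp 2 fun i => x (i, j)) j = x := by
  ext ⟨i, j⟩
  simp [tensorSingle]

lemma dotProduct_mulVec_tensorSingle (X : Matrix (Fin 3 × Fin 3) (Fin 3 × Fin 3) ℂ)
    (v w : EuclideanSpace ℂ (Fin 3)) (j k : Fin 3) :
    star (tensorSingle v j).ofLp ⬝ᵥ X *ᵥ (tensorSingle w k).ofLp =
      ∑ i, ∑ i', star (v i) * (X (i, j) (i', k) * w i') := by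
  simp [dotProduct, mulVec, Fintype.sum_prod_type, tensorSingle, Finset.mul_sum, apply_ite star]

lemma dotProduct_idTensor_PhiC_same (ρ : Matrix (Fin 3 × Fin 3) (Fin 3 × Fin 3) ℂ)
    (v : EuclideanSpace ℂ (Fin 3)) (j : Fin 3) :
    star (tensorSingle v j).ofLp ⬝ᵥ idTensor PhiC ρ *ᵥ (tensorSingle v j).ofLp =
      1 / 2 * (star (tensorSingle v j).ofLp ⬝ᵥ ρ *ᵥ (tensorSingle v j).ofLp +
        star (tensorSingle v (j + 1)).ofLp ⬝ᵥ ρ *ᵥ (tensorSingle v (j + 1)).ofLp) := by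
  simp only [dotProduct_mulVec_tensorSingle, ← Finset.sum_add_distrib, Finset.mul_sum]
  refine Finset.sum_congr rfl fun i _ => Finset.sum_congr rfl fun i' _ => ?_
  fin_cases j <;> simp [idTensor, PhiC] <;> ring

lemma dotProduct_idTensor_PhiC_of_ne (ρ : Matrix (Fin 3 × Fin 3) (Fin 3 × Fin 3) ℂ)
    (v w : EuclideanSpace ℂ (Fin 3)) {j k : Fin 3} (hjk : j ≠ k) :
    star (tensorSingle v j).ofLp ⬝ᵥ idTensor PhiC ρ *ᵥ (tensorSingle w k).ofLp =
      -(1 / 2) * (star (tensorSingle v j).ofLp ⬝ᵥ ρ *ᵥ (tensorSingle w k).ofLp) := by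
  simp only [dotProduct_mulVec_tensorSingle, Finset.mul_sum]
  refine Finset.sum_congr rfl fun i _ => Finset.sum_congr rfl fun i' _ => ?_
  fin_cases j <;> fin_cases k <;> first
    | exact absurd rfl hjk
    | (simp [idTensor, PhiC]; ring)

lemma dotProduct_idTensor_PhiC (ρ : Matrix (Fin 3 × Fin 3) (Fin 3 × Fin 3) ℂ)
    (v : Fin 3 → EuclideanSpace ℂ (Fin 3)) :
    star (∑ j, tensorSingle (v j) j).ofLp ⬝ᵥ idTensor PhiC ρ *ᵥ (∑ j, tensorSingle (v j) j).ofLp =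
      1 / 2 * (∑ j, (2 * (star (tensorSingle (v j) j).ofLp ⬝ᵥ ρ *ᵥ (tensorSingle (v j) j).ofLp) +
        star (tensorSingle (v j) (j + 1)).ofLp ⬝ᵥ ρ *ᵥ (tensorSingle (v j) (j + 1)).ofLp) -
        star (∑ j, tensorSingle (v j) j).ofLp ⬝ᵥ ρ *ᵥ (∑ j, tensorSingle (v j) j).ofLp) := by
  simp only [Fin.sum_univ_three, WithLp.ofLp_add, star_add, mulVec_add, dotProduct_add,
    add_dotProduct, dotProduct_idTensor_PhiC_same]
  rw [dotProduct_idTensor_PhiC_of_ne ρ (v 0) (v 1) (by decide),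
    dotProduct_idTensor_PhiC_of_ne ρ (v 0) (v 2) (by decide),
    dotProduct_idTensor_PhiC_of_ne ρ (v 1) (v 0) (by decide),
    dotProduct_idTensor_PhiC_of_ne ρ (v 1) (v 2) (by decide),
    dotProduct_idTensor_PhiC_of_ne ρ (v 2) (v 0) (by decide),
    dotProduct_idTensor_PhiC_of_ne ρ (v 2) (v 1) (by decide)]
  ring

/-- The Choi map cannot detect entanglement in any absolutely PPT state on `ℂ³ ⊗ ℂ³`. -/
theorem choi_map_of_absPPT (ρ : Matrix (Fin 3 × Fin 3) (Fin 3 × Fin 3) ℂ)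
    (hρ : ρ.PosSemidef) (htr : ρ.trace = 1) (hppt : AbsolutelyPPT ρ) :
    (idTensor PhiC ρ).PosSemidef := by
  obtain ⟨b, l, hl, hl0, hb⟩ := exists_antitone_eigenbasis hρ
  refine .of_dotProduct_mulVec_nonneg (idTensor_PhiC_isHermitian hρ.1) fun x => ?_
  have hform : ∀ y : EuclideanSpace ℂ (Fin 3 × Fin 3),
      star y.ofLp ⬝ᵥ ρ *ᵥ y.ofLp = ((∑ i, l i * ‖inner ℂ (b i) y‖ ^ 2 : ℝ) : ℂ) := by
    intro y
    rw [dotProduct_mulVec_eigenvector b hb]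
    push_cast
    refine Finset.sum_congr rfl fun i _ => ?_
    rw [← inner_conj_symm y (b i), Complex.conj_mul']
  have hpolar : ∀ v : EuclideanSpace ℂ (Fin 3), ∃ u, ‖u‖ = 1 ∧ v = ((‖v‖ : ℝ) : ℂ) • u := by
    intro v
    by_cases hv : v = 0
    · exact ⟨EuclideanSpace.single 0 1, by simp, by simp [hv]⟩
    · refine ⟨((‖v‖ : ℝ) : ℂ)⁻¹ • v, ?_, ?_⟩
      · simp [norm_smul, hv]
      · rw [smul_inv_smul₀ (by simpa using hv)]
  let v : Fin 3 → EuclideanSpace ℂ (Fin 3) := fun j => WithLp.toLp 2 fun i => x (i, j)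
  choose u hu huv using fun j => hpolar (v j)
  have hx : x = (∑ j, tensorSingle (v j) j).ofLp :=
    congrArg WithLp.ofLp (sum_tensorSingle (WithLp.toLp 2 x)).symm
  have main := choi_form_nonneg b hl (hl0 8) (eigenvalue_bound_of_absolutelyPPT hppt b hb)
    (orthonormal_tensorSingle hu Function.injective_id)
    (orthonormal_tensorSingle hu (add_left_injective 1)) (p := fun j => ‖v j‖)
    (fun j => norm_nonneg _)
  have hsc : ∀ j k i, ‖inner ℂ (b i) (tensorSingle (v j) k)‖ ^ 2 =
      ‖v j‖ ^ 2 * ‖inner ℂ (b i) (tensorSingle (u j) k)‖ ^ 2 := by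
    intro j k i
    conv_lhs => rw [huv j, tensorSingle_smul, inner_smul_right]
    simp [mul_pow]
  have hsum : ∑ j, ((‖v j‖ : ℝ) : ℂ) • tensorSingle (u j) (id j) = ∑ j, tensorSingle (v j) j :=
    Finset.sum_congr rfl fun j _ => by rw [← tensorSingle_smul, ← huv, id]
  rw [hsum] at main
  rw [hx, dotProduct_idTensor_PhiC]
  simp only [hform]
  refine (Complex.zero_le_real.2 (mul_nonneg one_half_pos.le main)).trans_eq ?_
  simp only [mul_sub, Finset.sum_sub_distrib, Finset.mul_sum, hsc, id]
  rw [Finset.sum_comm]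
  push_cast
  simp only [Finset.mul_sum, ← Finset.sum_add_distrib]
  congr 1
  refine Finset.sum_congr rfl fun j _ => Finset.sum_congr rfl fun i _ => ?_
  ring

end
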